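/- For every integer m ≥ 1, the holey square 𝓗(m,m+1) has exactly 2 domino tilings, and the region H(m,m+1) has exactly 1 domino tiling. -/

import Mathlib

/-- Two cells of `ℤ × ℤ` are adjacent if they differ by `(1,0)` or `(0,1)`. -/
def Adjacent (a b : ℤ × ℤ) : Prop :=
  (a.1 = b.1 ∧ (a.2 = b.2 + 1 ∨ b.2 = a.2 + 1)) ∨
  (a.2 = b.2 ∧ (a.1 = b.1 + 1 ∨ b.1 = a.1 + 1))

/-- `T` is a domino tiling of `R`: a partition of `R` into two-element sets of adjacent cells. -/
def IsDominoTiling (R : Set (ℤ × ℤ)) (T : Set (Set (ℤ × ℤ))) : Prop :=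
  (∀ d ∈ T, ∃ a b, Adjacent a b ∧ d = {a, b}) ∧
  T.PairwiseDisjoint id ∧
  ⋃₀ T = R

/-- The number of domino tilings of `R`. -/
noncomputable def numTilings (R : Set (ℤ × ℤ)) : ℕ :=
  Nat.card {T : Set (Set (ℤ × ℤ)) // IsDominoTiling R T}

/-- The holey square `𝓗(m,n)`: the `2n × 2n` square with a centered `2m × 2m` hole. -/
def holeySquare (m n : ℕ) : Set (ℤ × ℤ) :=
  {q | 0 ≤ q.1 ∧ q.1 < 2 * n ∧ 0 ≤ q.2 ∧ q.2 < 2 * n ∧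
    ¬((n : ℤ) - m ≤ q.1 ∧ q.1 < (n : ℤ) + m ∧ (n : ℤ) - m ≤ q.2 ∧ q.2 < (n : ℤ) + m)}

/-- The region `H(m,n)`: the lower half of the holey square cut along the staircase. -/
def Hreg (m n : ℕ) : Set (ℤ × ℤ) :=
  {q | 0 ≤ q.1 ∧ q.1 < 2 * n ∧ 0 ≤ q.2 ∧ q.2 ≤ 2 * (n : ℤ) - 2 - 2 * (q.1 / 2) ∧
    ¬((n : ℤ) - m ≤ q.1 ∧ q.1 < (n : ℤ) + m ∧ (n : ℤ) - m ≤ q.2 ∧ q.2 < (n : ℤ) + m)}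

lemma adj_symm {a b : ℤ × ℤ} (h : Adjacent a b) : Adjacent b a := by
  unfold Adjacent at *; omega

lemma tiling_cover {R : Set (ℤ × ℤ)} {T : Set (Set (ℤ × ℤ))} (hT : IsDominoTiling R T)
    {a : ℤ × ℤ} (ha : a ∈ R) : ∃ b ∈ R, Adjacent a b ∧ ({a, b} : Set (ℤ × ℤ)) ∈ T := by
  obtain ⟨h1, h2, h3⟩ := hT
  rw [← h3] at ha ⊢
  obtain ⟨d, hd, had⟩ := ha
  obtain ⟨p, q, hpq, rfl⟩ := h1 d hd
  rcases had with rfl | had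
  · exact ⟨q, ⟨_, hd, by simp⟩, hpq, hd⟩
  · obtain rfl : a = q := had
    exact ⟨p, ⟨_, hd, by simp⟩, adj_symm hpq, by rwa [Set.pair_comm]⟩

lemma tiling_uniq {R : Set (ℤ × ℤ)} {T : Set (Set (ℤ × ℤ))} (hT : IsDominoTiling R T)
    {d e : Set (ℤ × ℤ)} (hd : d ∈ T) (he : e ∈ T) {a : ℤ × ℤ} (h1 : a ∈ d) (h2 : a ∈ e) :
    d = e := by
  by_contra hne
  exact Set.disjoint_left.1 (hT.2.1 hd he hne) h1 h2

lemma tiling_eq_of_subset {R : Set (ℤ × ℤ)} {T U : Set (Set (ℤ × ℤ))}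
    (hT : IsDominoTiling R T) (hU : IsDominoTiling R U) (h : T ⊆ U) : U = T := by
  apply Set.Subset.antisymm _ h
  intro d hd
  obtain ⟨p, q, hpq, rfl⟩ := hU.1 d hd
  have hp : p ∈ R := by rw [← hU.2.2]; exact ⟨_, hd, by simp⟩
  obtain ⟨b, -, -, hb⟩ := tiling_cover hT hp
  rw [tiling_uniq hU hd (h hb) (a := p) (by simp) (by simp)]
  exact hb

/-- the tiling along a path -/
def pathTiling (f : ℤ → ℤ × ℤ) (s k : ℤ) : Set (Set (ℤ × ℤ)) :=
  {d | ∃ i, 0 ≤ i ∧ i < k ∧ d = {f (s + 2 * i), f (s + 2 * i + 1)}}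

lemma pathTiling_isTiling (f : ℤ → ℤ × ℤ) (s k : ℤ) (R : Set (ℤ × ℤ))
    (hinj : ∀ i j, s ≤ i → i < s + 2 * k → s ≤ j → j < s + 2 * k → f i = f j → i = j)
    (hadj : ∀ i, s ≤ i → i + 1 < s + 2 * k → Adjacent (f i) (f (i + 1)))
    (hR : ∀ a, a ∈ R ↔ ∃ i, s ≤ i ∧ i < s + 2 * k ∧ a = f i) :
    IsDominoTiling R (pathTiling f s k) := by
  refine ⟨?_, ?_, ?_⟩
  · rintro d ⟨i, h0, h1, rfl⟩
    exact ⟨_, _, hadj _ (by omega) (by omega), rfl⟩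
  · rintro d ⟨i, h0, h1, rfl⟩ e ⟨j, h2, h3, rfl⟩ hne
    have hij : i ≠ j := by rintro rfl; exact hne rfl
    simp only [Function.onFun, id]
    rw [Set.disjoint_left]
    rintro a (ha | ha) (hb | hb)
    all_goals
      have ha' : a = _ := ha
      have hb' : a = _ := hb
      have := hinj _ _ (by omega) (by omega) (by omega) (by omega) (ha'.symm.trans hb')
      omega
  · ext a
    rw [hR]
    constructor
    · rintro ⟨d, ⟨i, h0, h1, rfl⟩, (ha | ha)⟩
      · exact ⟨_, by omega, by omega, ha⟩
      · exact ⟨_, by omega, by omega, ha⟩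
    · rintro ⟨j, h0, h1, rfl⟩
      refine ⟨_, ⟨(j - s) / 2, by omega, by omega, rfl⟩, ?_⟩
      rcases Int.emod_two_eq_zero_or_one (j - s) with h | h
      · left; congr 1; omega
      · right; show f j = _; congr 1; omega

lemma pathTiling_forced (f : ℤ → ℤ × ℤ) (s k : ℤ) (R : Set (ℤ × ℤ))
    (hinj : ∀ i j, s ≤ i → i < s + 2 * k → s ≤ j → j < s + 2 * k → f i = f j → i = j)
    (hadj : ∀ i, s ≤ i → i + 1 < s + 2 * k → Adjacent (f i) (f (i + 1)))
    (hR : ∀ a, a ∈ R ↔ ∃ i, s ≤ i ∧ i < s + 2 * k ∧ a = f i)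
    (hN : ∀ j, s < j → j + 1 < s + 2 * k → ∀ b ∈ R, Adjacent (f j) b →
      b = f (j - 1) ∨ b = f (j + 1))
    (T : Set (Set (ℤ × ℤ))) (hT : IsDominoTiling R T)
    (h0 : ({f s, f (s + 1)} : Set (ℤ × ℤ)) ∈ T) : T = pathTiling f s k := by
  apply tiling_eq_of_subset (pathTiling_isTiling f s k R hinj hadj hR) hT
  have key : ∀ n : ℕ, (n : ℤ) < k →
      ({f (s + 2 * n), f (s + 2 * n + 1)} : Set (ℤ × ℤ)) ∈ T := by
    intro n
    induction n with
    | zero => intro _; simpa using h0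
    | succ n ih =>
      intro hn
      push_cast at hn ⊢
      have ih := ih (by omega)
      have hm : f (s + 2 * (n + 1)) ∈ R := (hR _).2 ⟨_, by omega, by omega, rfl⟩
      obtain ⟨b, hbR, hb, hbT⟩ := tiling_cover hT hm
      rcases hN _ (by omega) (by omega) b hbR hb with rfl | rfl
      · exfalso
        have e : s + 2 * ((n : ℤ) + 1) - 1 = s + 2 * n + 1 := by ring
        rw [e] at hbT
        have := tiling_uniq hT hbT ih (a := f (s + 2 * n + 1)) (by simp) (by simp)
        have h2 : f (s + 2 * ((n : ℤ) + 1)) ∈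
          ({f (s + 2 * n), f (s + 2 * n + 1)} : Set (ℤ × ℤ)) := by rw [← this]; simp
        rcases h2 with h2 | h2
        · have := hinj _ _ (by omega) (by omega) (by omega) (by omega) h2
          omega
        · have := hinj _ _ (by omega) (by omega) (by omega) (by omega) h2
          omega
      · exact hbT
  rintro d ⟨i, hi, hk, rfl⟩
  lift i to ℕ using hi
  exact key i hk

/-- the walk around the ring -/
def ringWalk (m : ℤ) (i : ℤ) : ℤ × ℤ :=
  (max 0 (min (i - 2 * m) (min (2 * m + 1) (8 * m + 3 - i))),
   max (2 * m - i) (max 0 (min (i - 4 * m - 1) (2 * m + 1))))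

lemma ring_inj (m s : ℤ) (hm : 1 ≤ m) (hs : s = 0 ∨ s = -1) (i j : ℤ) (h1 : s ≤ i)
    (h2 : i < s + 2 * (4 * m + 2)) (h3 : s ≤ j) (h4 : j < s + 2 * (4 * m + 2))
    (h : ringWalk m i = ringWalk m j) : i = j := by
  simp only [ringWalk, Prod.mk.injEq] at h
  omega

lemma ring_adj (m s : ℤ) (hm : 1 ≤ m) (hs : s = 0 ∨ s = -1) (i : ℤ) (h1 : s ≤ i)
    (h2 : i + 1 < s + 2 * (4 * m + 2)) : Adjacent (ringWalk m i) (ringWalk m (i + 1)) := by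
  simp only [ringWalk, Adjacent]
  omega

lemma ring_mem (m : ℕ) (s : ℤ) (hm : 1 ≤ m) (hs : s = 0 ∨ s = -1) (a : ℤ × ℤ) :
    a ∈ holeySquare m (m + 1) ↔
      ∃ i, s ≤ i ∧ i < s + 2 * (4 * (m : ℤ) + 2) ∧ a = ringWalk m i := by
  obtain ⟨x, y⟩ := a
  simp only [holeySquare, Set.mem_setOf_eq, ringWalk, Prod.mk.injEq]
  push_cast
  constructor
  · intro h
    by_cases c1 : x = 0 ∧ y = 2 * m + 1
    · rcases hs with rfl | rfl
      · exact ⟨8 * m + 3, by omega⟩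
      · exact ⟨-1, by omega⟩
    by_cases c2 : x = 0
    · exact ⟨2 * m - y, by omega⟩
    by_cases c3 : y = 0
    · exact ⟨2 * m + x, by omega⟩
    by_cases c4 : x = 2 * m + 1
    · exact ⟨4 * m + 1 + y, by omega⟩
    · exact ⟨8 * m + 3 - x, by omega⟩
  · rintro ⟨i, h⟩
    omega

lemma walk1 (m i : ℤ) (hm : 1 ≤ m) (h : i ≤ 2 * m) : ringWalk m i = (0, 2 * m - i) := by
  simp only [ringWalk, Prod.mk.injEq]; omega

lemma walk2 (m i : ℤ) (hm : 1 ≤ m) (h : 2 * m ≤ i) (h' : i ≤ 4 * m + 1) :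
    ringWalk m i = (i - 2 * m, 0) := by
  simp only [ringWalk, Prod.mk.injEq]; omega

lemma walk3 (m i : ℤ) (hm : 1 ≤ m) (h : 4 * m + 1 ≤ i) (h' : i ≤ 6 * m + 2) :
    ringWalk m i = (2 * m + 1, i - 4 * m - 1) := by
  simp only [ringWalk, Prod.mk.injEq]; omega

lemma walk4 (m i : ℤ) (hm : 1 ≤ m) (h : 6 * m + 2 ≤ i) (h' : i ≤ 8 * m + 3) :
    ringWalk m i = (8 * m + 3 - i, 2 * m + 1) := by
  simp only [ringWalk, Prod.mk.injEq]; omega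

lemma ring_nbr (m : ℕ) (s : ℤ) (hm : 1 ≤ m) (hs : s = 0 ∨ s = -1) (j : ℤ) (h1 : -1 < j)
    (h2 : j + 1 < 2 * (4 * (m : ℤ) + 2)) (b : ℤ × ℤ) (hb : b ∈ holeySquare m (m + 1))
    (h : Adjacent (ringWalk m j) b) : b = ringWalk m (j - 1) ∨ b = ringWalk m (j + 1) := by
  clear hs
  have hm' : (1 : ℤ) ≤ m := by exact_mod_cast hm
  obtain ⟨x, y⟩ := b
  simp only [holeySquare, Set.mem_setOf_eq] at hb
  push_cast at hb
  have hj : j < 2 * m ∨ j = 2 * m ∨ (2 * m < j ∧ j < 4 * m + 1) ∨ j = 4 * m + 1 ∨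
    (4 * m + 1 < j ∧ j < 6 * m + 2) ∨ j = 6 * m + 2 ∨ 6 * m + 2 < j := by omega
  rcases hj with c | c | c | c | c | c | c
  · rw [walk1 m j hm' (by omega)] at h
    rw [walk1 m (j - 1) hm' (by omega), walk1 m (j + 1) hm' (by omega)]
    simp only [Adjacent, Prod.mk.injEq] at *
    omega
  · rw [walk1 m j hm' (by omega)] at h
    rw [walk1 m (j - 1) hm' (by omega), walk2 m (j + 1) hm' (by omega) (by omega)]
    simp only [Adjacent, Prod.mk.injEq] at *
    omega
  · rw [walk2 m j hm' (by omega) (by omega)] at h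
    rw [walk2 m (j - 1) hm' (by omega) (by omega), walk2 m (j + 1) hm' (by omega) (by omega)]
    simp only [Adjacent, Prod.mk.injEq] at *
    omega
  · rw [walk2 m j hm' (by omega) (by omega)] at h
    rw [walk2 m (j - 1) hm' (by omega) (by omega), walk3 m (j + 1) hm' (by omega) (by omega)]
    simp only [Adjacent, Prod.mk.injEq] at *
    omega
  · rw [walk3 m j hm' (by omega) (by omega)] at h
    rw [walk3 m (j - 1) hm' (by omega) (by omega), walk3 m (j + 1) hm' (by omega) (by omega)]
    simp only [Adjacent, Prod.mk.injEq] at *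
    omega
  · rw [walk3 m j hm' (by omega) (by omega)] at h
    rw [walk3 m (j - 1) hm' (by omega) (by omega), walk4 m (j + 1) hm' (by omega) (by omega)]
    simp only [Adjacent, Prod.mk.injEq] at *
    omega
  · rw [walk4 m j hm' (by omega) (by omega)] at h
    rw [walk4 m (j - 1) hm' (by omega) (by omega), walk4 m (j + 1) hm' (by omega) (by omega)]
    simp only [Adjacent, Prod.mk.injEq] at *
    omega

lemma path_mem (m : ℕ) (hm : 1 ≤ m) (a : ℤ × ℤ) :
    a ∈ Hreg m (m + 1) ↔
      ∃ i, (0 : ℤ) ≤ i ∧ i < 0 + 2 * (2 * (m : ℤ) + 1) ∧ a = ringWalk m i := by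
  obtain ⟨x, y⟩ := a
  simp only [Hreg, Set.mem_setOf_eq, ringWalk, Prod.mk.injEq]
  push_cast
  constructor
  · intro h
    by_cases c2 : x = 0
    · exact ⟨2 * m - y, by omega⟩
    · exact ⟨2 * m + x, by omega⟩
  · rintro ⟨i, h⟩
    omega

theorem holey_square_base_case (m : ℕ) (hm : 1 ≤ m) :
    numTilings (holeySquare m (m + 1)) = 2 ∧ numTilings (Hreg m (m + 1)) = 1 := by
  have hm' : (1 : ℤ) ≤ m := by exact_mod_cast hm
  constructor
  · have tA := pathTiling_isTiling (ringWalk m) 0 (4 * m + 2) _ (ring_inj m 0 hm' (by simp))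
      (ring_adj m 0 hm' (by simp)) (ring_mem m 0 hm (by simp))
    have tB := pathTiling_isTiling (ringWalk m) (-1) (4 * m + 2) _ (ring_inj m (-1) hm' (by simp))
      (ring_adj m (-1) hm' (by simp)) (ring_mem m (-1) hm (by simp))
    have hset : {T | IsDominoTiling (holeySquare m (m + 1)) T} =
        {pathTiling (ringWalk m) 0 (4 * m + 2), pathTiling (ringWalk m) (-1) (4 * m + 2)} := by
      ext T
      constructor
      · intro hT
        have h0 : ringWalk m 0 ∈ holeySquare m (m + 1) :=
          (ring_mem m 0 hm (by simp) _).2 ⟨0, by omega, by omega, rfl⟩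
        obtain ⟨b, hbR, hb, hbT⟩ := tiling_cover hT h0
        rcases ring_nbr m 0 hm (by simp) 0 (by omega) (by omega) b hbR hb with rfl | rfl
        · right
          refine pathTiling_forced (ringWalk m) (-1) (4 * m + 2) _ (ring_inj m (-1) hm' (by simp))
            (ring_adj m (-1) hm' (by simp)) (ring_mem m (-1) hm (by simp)) ?_ T hT ?_
          · intro j h1 h2
            exact ring_nbr m 0 hm (by simp) j (by omega) (by omega)
          · rw [Set.pair_comm]; exact hbT
        · left
          refine pathTiling_forced (ringWalk m) 0 (4 * m + 2) _ (ring_inj m 0 hm' (by simp))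
            (ring_adj m 0 hm' (by simp)) (ring_mem m 0 hm (by simp)) ?_ T hT hbT
          intro j h1 h2
          exact ring_nbr m 0 hm (by simp) j (by omega) (by omega)
      · rintro (rfl | hT)
        · exact tA
        · obtain rfl : T = _ := hT
          exact tB
    have hne : pathTiling (ringWalk m) 0 (4 * m + 2) ≠
        pathTiling (ringWalk m) (-1) (4 * m + 2) := by
      intro h
      have e1 : ({ringWalk m 0, ringWalk m 1} : Set (ℤ × ℤ)) ∈
          pathTiling (ringWalk m) (-1) (4 * m + 2) := by
        rw [← h]; exact ⟨0, by omega, by omega, by norm_num⟩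
      have e2 : ({ringWalk m (-1), ringWalk m 0} : Set (ℤ × ℤ)) ∈
          pathTiling (ringWalk m) (-1) (4 * m + 2) :=
        ⟨0, by omega, by omega, by norm_num⟩
      have e3 := tiling_uniq tB e1 e2 (a := ringWalk m 0) (by simp) (by simp)
      have e4 : ringWalk m 1 ∈ ({ringWalk m (-1), ringWalk m 0} : Set (ℤ × ℤ)) := by
        rw [← e3]; simp
      rcases e4 with e4 | e4
      · have := ring_inj m (-1) hm' (by simp) _ _ (by omega) (by omega) (by omega) (by omega) e4
        omega
      · have := ring_inj m (-1) hm' (by simp) _ _ (by omega) (by omega) (by omega) (by omega) e4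
        omega
    have := Set.ncard_pair hne
    rw [← hset] at this
    exact this
  · have hi : ∀ i j, (0 : ℤ) ≤ i → i < 0 + 2 * (2 * (m : ℤ) + 1) → 0 ≤ j →
        j < 0 + 2 * (2 * (m : ℤ) + 1) → ringWalk m i = ringWalk m j → i = j :=
      fun i j h1 h2 h3 h4 => ring_inj m 0 hm' (by simp) i j (by omega) (by omega) (by omega)
        (by omega)
    have ha : ∀ i, (0 : ℤ) ≤ i → i + 1 < 0 + 2 * (2 * (m : ℤ) + 1) →
        Adjacent (ringWalk m i) (ringWalk m (i + 1)) :=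
      fun i h1 h2 => ring_adj m 0 hm' (by simp) i (by omega) (by omega)
    have hsub : ∀ b ∈ Hreg m (m + 1), b ∈ holeySquare m (m + 1) := by
      intro b hb
      obtain ⟨i, h1, h2, h3⟩ := (path_mem m hm b).1 hb
      exact (ring_mem m 0 hm (by simp) b).2 ⟨i, by omega, by omega, h3⟩
    have tA := pathTiling_isTiling (ringWalk m) 0 (2 * m + 1) _ hi ha (path_mem m hm)
    have hset : {T | IsDominoTiling (Hreg m (m + 1)) T} =
        {pathTiling (ringWalk m) 0 (2 * m + 1)} := by
      ext T
      constructor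
      · intro hT
        have h0 : ringWalk m 0 ∈ Hreg m (m + 1) :=
          (path_mem m hm _).2 ⟨0, by omega, by omega, rfl⟩
        obtain ⟨b, hbR, hb, hbT⟩ := tiling_cover hT h0
        rcases ring_nbr m 0 hm (by simp) 0 (by omega) (by omega) b (hsub b hbR) hb with rfl | rfl
        · exfalso
          obtain ⟨i, h1, h2, h3⟩ := (path_mem m hm _).1 hbR
          have := ring_inj m (-1) hm' (by simp) _ _ (by omega) (by omega) (by omega) (by omega) h3
          omega
        · refine pathTiling_forced (ringWalk m) 0 (2 * m + 1) _ hi ha (path_mem m hm) ?_ T hT hbT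
          intro j h1 h2 b hb
          exact ring_nbr m 0 hm (by simp) j (by omega) (by omega) b (hsub b hb)
      · intro hT
        obtain rfl : T = _ := hT
        exact tA
    have := Set.ncard_singleton (pathTiling (ringWalk m) 0 (2 * m + 1))
    rw [← hset] at this
    exact this
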